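/- arXiv:1003.5019 — 6 statements merged into one kernel-verified Lean document; each statement's English description precedes it below -/
import Mathlib

section
/- Every indecomposable representation (V, x) of the linearly oriented A_n quiver (with all V_k finite-dimensional complex vector spaces) is isomorphic to (V^{i,j}, x^{i,j}) for a unique pair 1 ≤ i ≤ j ≤ n. In particular, an indecomposable representation satisfies dim V_k = 1 for i ≤ k ≤ j and V_k = 0 otherwise, and the maps x_k are bijective for i ≤ k ≤ j−1. -/
open Module

section TransitionMaps

variable {R : Type*} [Semiring R] {V : ℕ → Type*} [∀ k, AddCommMonoid (V k)] [∀ k, Module R (V k)]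
  (x : ∀ k, V (k + 1) →ₗ[R] V k)

/-- The composite `V j → V k` of the maps `x` when `k ≤ j`, and zero when `j < k`. -/
def transitionMap : ∀ j k, V j →ₗ[R] V k
  | 0 => Function.update 0 0 LinearMap.id
  | j + 1 => Function.update (fun k => (transitionMap j k).comp (x j)) (j + 1) LinearMap.id

theorem transitionMap_self (j : ℕ) : transitionMap x j j = LinearMap.id := by
  cases j <;> simp [transitionMap]

theorem transitionMap_succ_left {j k : ℕ} (h : k ≠ j + 1) :
    transitionMap x (j + 1) k = (transitionMap x j k).comp (x j) := by
  simp [transitionMap, h]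

theorem transitionMap_of_lt {j k : ℕ} (h : j < k) : transitionMap x j k = 0 := by
  induction j with
  | zero => simp [transitionMap, h.ne']
  | succ j ih => rw [transitionMap_succ_left x h.ne', ih (by lia), LinearMap.zero_comp]

theorem comp_transitionMap {j k : ℕ} (h : k < j) :
    (x k).comp (transitionMap x j (k + 1)) = transitionMap x j k := by
  induction j with
  | zero => lia
  | succ j ih =>
    rw [transitionMap_succ_left x h.ne]
    rcases Nat.lt_succ_iff_lt_or_eq.mp h with hk | rfl
    · rw [transitionMap_succ_left x (by lia), ← LinearMap.comp_assoc, ih hk]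
    · simp [transitionMap_self]

theorem transitionMap_comp {i j k : ℕ} (hik : i ≤ k) (hkj : k ≤ j) :
    (transitionMap x k i).comp (transitionMap x j k) = transitionMap x j i := by
  induction j, hkj using Nat.le_induction with
  | base => rw [transitionMap_self, LinearMap.comp_id]
  | succ j hj ih =>
    rw [transitionMap_succ_left x (by lia), transitionMap_succ_left x (by lia),
      ← LinearMap.comp_assoc, ih]

end TransitionMaps

theorem isCompl_span_singleton_ker {K V : Type*} [Field K] [AddCommGroup V] [Module K V]
    (f : V →ₗ[K] K) {v : V} (hv : f v ≠ 0) : IsCompl (K ∙ v) (LinearMap.ker f) := by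
  refine ⟨?_, codisjoint_iff.mpr (f.span_singleton_sup_ker_eq_top hv)⟩
  rw [Submodule.disjoint_def]
  intro w hw hfw
  obtain ⟨a, rfl⟩ := Submodule.mem_span_singleton.mp hw
  have ha : a = 0 := by simpa [hv] using hfw
  simp [ha]

/-- Every indecomposable representation `(V, x)` of the linearly oriented `A_n`
quiver is isomorphic to the interval representation `(V^{i,j}, x^{i,j})` for a
unique pair `1 ≤ i ≤ j ≤ n`.  The vector spaces are indexed by `ℕ`, with the
spaces at `k = 0` and `k > n` required to be zero; the map `x k` goes from the
space at `k+1` to the space at `k`.  An isomorphism with `(V^{i,j}, x^{i,j})` is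
encoded by a family `ψ k : V k →ₗ ℂ` which is bijective for `i ≤ k ≤ j` and
intertwines `x k` with the identity of `ℂ` for `i ≤ k ≤ j-1`, together with
`V k = 0` for `k` outside `[i, j]`.  In particular `dim V k = 1` for `i ≤ k ≤ j`,
`V k = 0` otherwise, and the maps `x k` are bijective for `i ≤ k ≤ j-1`. -/
theorem indecomposable_rep_An_is_interval
    (n : ℕ) (hn : 1 ≤ n)
    (V : ℕ → Type) [∀ k, AddCommGroup (V k)] [∀ k, Module ℂ (V k)]
    [∀ k, FiniteDimensional ℂ (V k)]
    (hVout : ∀ k, (k = 0 ∨ n < k) → finrank ℂ (V k) = 0)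
    (x : ∀ k, V (k+1) →ₗ[ℂ] V k)
    (hnonzero : ∃ k, finrank ℂ (V k) ≠ 0)
    (hindec : ∀ S T : ∀ k, Submodule ℂ (V k),
      (∀ k, Submodule.map (x k) (S (k+1)) ≤ S k) →
      (∀ k, Submodule.map (x k) (T (k+1)) ≤ T k) →
      (∀ k, S k ⊓ T k = ⊥) → (∀ k, S k ⊔ T k = ⊤) →
      (∀ k, S k = ⊥) ∨ (∀ k, T k = ⊥)) :
    ∃! p : ℕ × ℕ,
      (1 ≤ p.1 ∧ p.1 ≤ p.2 ∧ p.2 ≤ n) ∧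
      ∃ ψ : ∀ k, V k →ₗ[ℂ] ℂ,
        (∀ k, p.1 ≤ k → k ≤ p.2 → Function.Bijective (ψ k)) ∧
        (∀ k, ¬(p.1 ≤ k ∧ k ≤ p.2) → finrank ℂ (V k) = 0) ∧
        (∀ k, p.1 ≤ k → k + 1 ≤ p.2 → (ψ k).comp (x k) = ψ (k+1)) ∧
        (∀ k, p.1 ≤ k → k + 1 ≤ p.2 → Function.Bijective (x k)) := by
  have hbdd : ∀ k, finrank ℂ (V k) ≠ 0 → k ≤ n := fun k hk => by
    by_contra! h
    exact hk (hVout k (Or.inr h))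
  obtain ⟨j, hj, hjmax⟩ : ∃ j, finrank ℂ (V j) ≠ 0 ∧ ∀ k, j < k → finrank ℂ (V k) = 0 := by
    classical
    obtain ⟨k, hk⟩ := hnonzero
    refine ⟨Nat.findGreatest (fun k => finrank ℂ (V k) ≠ 0) n,
      Nat.findGreatest_spec (P := fun k => finrank ℂ (V k) ≠ 0) (hbdd k hk) hk, fun l hl => ?_⟩
    by_contra h
    exact Nat.findGreatest_is_greatest hl (hbdd l h) h
  have : Nontrivial (V j) := nontrivial_of_finrank_pos (Nat.pos_of_ne_zero hj)
  obtain ⟨i, hi, himin⟩ : ∃ i, transitionMap x j i ≠ 0 ∧ ∀ k, k < i → transitionMap x j k = 0 := by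
    classical
    have hex : ∃ i, transitionMap x j i ≠ 0 := by
      obtain ⟨v, hv⟩ := exists_ne (0 : V j)
      exact ⟨j, fun h => hv (by simpa [transitionMap_self] using LinearMap.congr_fun h v)⟩
    exact ⟨Nat.find hex, Nat.find_spec hex, fun k hk => not_not.mp (Nat.find_min hex hk)⟩
  have hij : i ≤ j := not_lt.mp fun h => hi (transitionMap_of_lt x h)
  obtain ⟨v, hv⟩ : ∃ v, transitionMap x j i v ≠ 0 := by
    by_contra! h
    exact hi (LinearMap.ext h)
  obtain ⟨f, hf⟩ : ∃ f : Dual ℂ (V i), f (transitionMap x j i v) ≠ 0 := by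
    by_contra! h
    exact hv ((forall_dual_apply_eq_zero_iff ℂ _).mp h)
  have hi0 : 1 ≤ i := by
    by_contra h
    obtain rfl : i = 0 := by lia
    have : Subsingleton (V 0) := finrank_zero_iff.mp (hVout 0 (Or.inl rfl))
    exact hv (Subsingleton.elim _ _)
  set ψ : ∀ k, V k →ₗ[ℂ] ℂ := fun k => f.comp (transitionMap x k i) with hψ
  have hψv : ∀ k, i ≤ k → k ≤ j → ψ k (transitionMap x j k v) ≠ 0 := fun k hik hkj => by
    rwa [← transitionMap_comp x hik hkj] at hf
  have hψx : ∀ k, i ≤ k → (ψ k).comp (x k) = ψ (k + 1) := fun k hik => by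
    simp only [hψ, LinearMap.comp_assoc, transitionMap_succ_left x (show i ≠ k + 1 by lia)]
  have hψ0 : ∀ k, k < i → ψ k = 0 := fun k hk => by
    simp only [hψ, transitionMap_of_lt x hk, LinearMap.comp_zero]
  have hcompl : ∀ k, IsCompl (ℂ ∙ transitionMap x j k v) (LinearMap.ker (ψ k)) := by
    intro k
    rcases lt_or_ge k i with hki | hik
    · simpa [hψ0 k hki, himin k hki] using isCompl_bot_top
    rcases lt_or_ge j k with hjk | hkj
    · have : Subsingleton (V k) := finrank_zero_iff.mp (hjmax k hjk)
      rw [Subsingleton.elim (ℂ ∙ transitionMap x j k v) ⊥, Subsingleton.elim (LinearMap.ker (ψ k)) ⊤]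
      exact isCompl_bot_top
    · exact isCompl_span_singleton_ker _ (hψv k hik hkj)
  have hker : ∀ k, LinearMap.ker (ψ k) = ⊥ := by
    refine (hindec _ _ (fun k => ?_) (fun k => ?_) (fun k => (hcompl k).inf_eq_bot)
      (fun k => (hcompl k).sup_eq_top)).resolve_left fun h => ?_
    · rw [Submodule.map_span_le]
      rintro _ rfl
      rcases lt_or_ge k j with hkj | hjk
      · rw [← LinearMap.comp_apply, comp_transitionMap x hkj]
        exact Submodule.mem_span_singleton_self _
      · simp [transitionMap_of_lt x (show j < k + 1 by lia)]
    · rw [Submodule.map_le_iff_le_comap, ← LinearMap.ker_comp]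
      rcases lt_or_ge k i with hki | hik
      · simp [hψ0 k hki]
      · rw [hψx k hik]
    · exact hv (Submodule.span_singleton_eq_bot.mp (h i))
  have hbij : ∀ k, i ≤ k → k ≤ j → Function.Bijective (ψ k) := fun k hik hkj =>
    ⟨LinearMap.ker_eq_bot.mp (hker k),
      LinearMap.surjective fun h => hψv k hik hkj (by rw [h, LinearMap.zero_apply])⟩
  have hout : ∀ k, ¬(i ≤ k ∧ k ≤ j) → finrank ℂ (V k) = 0 := by
    intro k hk
    rcases lt_or_ge k i with hki | hik
    · have h := hker k
      rw [hψ0 k hki, LinearMap.ker_zero] at h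
      rw [← finrank_top, h, finrank_bot]
    · exact hjmax k (by lia)
  refine ⟨(i, j), ⟨⟨hi0, hij, hbdd j hj⟩, ψ, hbij, hout, fun k hik _ => hψx k hik,
    fun k hik hkj => ?_⟩, ?_⟩
  · rw [← Function.Bijective.of_comp_iff' (hbij k hik (by lia)), ← LinearMap.coe_comp, hψx k hik]
    exact hbij (k + 1) (by lia) hkj
  · rintro ⟨a, b⟩ ⟨⟨-, hab, -⟩, φ, hφ, hφout, -⟩
    dsimp only at hab hφ hφout
    have hsupp : ∀ k, (i ≤ k ∧ k ≤ j) ↔ (a ≤ k ∧ k ≤ b) := by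
      refine fun k => ⟨fun h => ?_, fun h => ?_⟩ <;> by_contra hk
      · have h1 := (LinearEquiv.ofBijective _ (hbij k h.1 h.2)).finrank_eq
        rw [hφout k hk, finrank_self] at h1
        exact zero_ne_one h1
      · have h1 := (LinearEquiv.ofBijective _ (hφ k h.1 h.2)).finrank_eq
        rw [hout k hk, finrank_self] at h1
        exact zero_ne_one h1
    have := hsupp i
    have := hsupp j
    have := hsupp a
    have := hsupp b
    rw [Prod.mk.injEq]
    lia
end

section
/- If (x, y) satisfies the moment map relations, then (x, y) is nilpotent. (Hence in type A_n the nilpotency condition in the definition of the Lusztig quiver variety Λ(v) is superfluous: Λ(v) equals the zero locus of the moment map.) -/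
noncomputable section

/-- The endpoint of a path in the double quiver of type `A_n`, starting at
vertex `u`: the step `true` uses an arrow `x` (decreasing the vertex by one)
and the step `false` uses an arrow `y` (increasing the vertex by one). -/
def pathEnd : List Bool → ℕ → ℕ
  | [], u => u
  | true :: w, u => pathEnd w (u - 1)
  | false :: w, u => pathEnd w (u + 1)

/-- The composition of the maps `x_k : V_{k+1} → V_k` and `y_k : V_k → V_{k+1}`
along the path `w` starting at vertex `u` (an invalid downward step from vertex
`0` gives the zero map; such steps leave the quiver anyway). -/
def pathComp (V : ℕ → Type) [∀ k, AddCommGroup (V k)] [∀ k, Module ℂ (V k)]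
    (x : ∀ k, V (k+1) →ₗ[ℂ] V k) (y : ∀ k, V k →ₗ[ℂ] V (k+1)) :
    (w : List Bool) → (u : ℕ) → (V u →ₗ[ℂ] V (pathEnd w u))
  | [], _ => LinearMap.id
  | true :: _, 0 => 0
  | true :: w, (v+1) => (pathComp V x y w v).comp (x v)
  | false :: w, u => (pathComp V x y w (u+1)).comp (y u)

section TotalSpace

variable {V : ℕ → Type} [∀ k, AddCommGroup (V k)] [∀ k, Module ℂ (V k)]

/-- The endomorphism of `∏ k, V k` assembled from maps `V (k + 1) → V k`. -/
def lowerEnd (x : ∀ k, V (k + 1) →ₗ[ℂ] V k) : Module.End ℂ (∀ k, V k) :=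
  LinearMap.pi fun k => (x k).comp (LinearMap.proj (k + 1))

/-- The endomorphism of `∏ k, V k` assembled from maps `V k → V (k + 1)`. -/
def raiseEnd (y : ∀ k, V k →ₗ[ℂ] V (k + 1)) : Module.End ℂ (∀ k, V k) :=
  LinearMap.pi fun
    | 0 => 0
    | k + 1 => (y k).comp (LinearMap.proj k)

@[simp]
lemma lowerEnd_apply (x : ∀ k, V (k + 1) →ₗ[ℂ] V k) (f : ∀ k, V k) (k : ℕ) :
    lowerEnd x f k = x k (f (k + 1)) := rfl

@[simp]
lemma raiseEnd_apply_zero (y : ∀ k, V k →ₗ[ℂ] V (k + 1)) (f : ∀ k, V k) :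
    raiseEnd y f 0 = 0 := rfl

@[simp]
lemma raiseEnd_apply_succ (y : ∀ k, V k →ₗ[ℂ] V (k + 1)) (f : ∀ k, V k) (k : ℕ) :
    raiseEnd y f (k + 1) = y k (f k) := rfl

lemma lowerEnd_single_succ (x : ∀ k, V (k + 1) →ₗ[ℂ] V k) (k : ℕ) (v : V (k + 1)) :
    lowerEnd x (Pi.single (k + 1) v) = Pi.single k (x k v) := by
  ext j
  rcases eq_or_ne j k with rfl | h
  · simp
  · simp [h]

lemma raiseEnd_single (y : ∀ k, V k →ₗ[ℂ] V (k + 1)) (k : ℕ) (v : V k) :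
    raiseEnd y (Pi.single k v) = Pi.single (k + 1) (y k v) := by
  ext j
  cases j with
  | zero => simp
  | succ j =>
    rcases eq_or_ne j k with rfl | h
    · simp
    · simp [h]

lemma commute_lowerEnd_raiseEnd [Subsingleton (V 0)]
    {x : ∀ k, V (k + 1) →ₗ[ℂ] V k} {y : ∀ k, V k →ₗ[ℂ] V (k + 1)}
    (hrel : ∀ k, (x (k + 1)).comp (y (k + 1)) = (y k).comp (x k)) :
    Commute (lowerEnd x) (raiseEnd y) := by
  refine LinearMap.ext fun f => funext fun k => ?_
  cases k with
  | zero => exact Subsingleton.elim _ _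
  | succ k => simpa using LinearMap.congr_fun (hrel k) (f (k + 1))

lemma lowerEnd_pow_eq_zero {n : ℕ} (hV : ∀ k, n < k → Subsingleton (V k))
    (x : ∀ k, V (k + 1) →ₗ[ℂ] V k) : lowerEnd x ^ (n + 1) = 0 := by
  have key : ∀ m k (f : ∀ k, V k), n < k + m → (lowerEnd x ^ m) f k = 0 := by
    intro m
    induction m with
    | zero => exact fun k f h => (hV k h).elim _ _
    | succ m ih =>
      intro k f h
      rw [pow_succ', Module.End.mul_apply, lowerEnd_apply, ih (k + 1) f (by omega), map_zero]
  exact LinearMap.ext fun f => funext fun k => key _ k f (by omega)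

lemma raiseEnd_pow_eq_zero {n : ℕ} (hV : ∀ k, n < k → Subsingleton (V k))
    (y : ∀ k, V k →ₗ[ℂ] V (k + 1)) : raiseEnd y ^ (n + 1) = 0 := by
  have key : ∀ m k (f : ∀ k, V k), k < m → (raiseEnd y ^ m) f k = 0 := by
    intro m
    induction m with
    | zero => exact fun k f h => absurd h (Nat.not_lt_zero k)
    | succ m ih =>
      intro k f h
      rw [pow_succ', Module.End.mul_apply]
      cases k with
      | zero => rfl
      | succ k => rw [raiseEnd_apply_succ, ih k f (by omega), map_zero]
  refine LinearMap.ext fun f => funext fun k => ?_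
  by_cases h : n < k
  · exact (hV k h).elim _ _
  · exact key _ k f (by omega)

end TotalSpace

/-- The product of two monoid elements along a word, the first letter acting first. -/
def wordProd {R : Type*} [Monoid R] (a b : R) : List Bool → R
  | [] => 1
  | true :: w => wordProd a b w * a
  | false :: w => wordProd a b w * b

lemma Commute.exists_wordProd_eq {R : Type*} [Monoid R] {a b : R} (h : Commute a b)
    (w : List Bool) : ∃ i j, i + j = w.length ∧ wordProd a b w = a ^ i * b ^ j := by
  induction w with
  | nil => exact ⟨0, 0, rfl, by simp [wordProd]⟩
  | cons c w ih =>
    obtain ⟨i, j, hij, hw⟩ := ih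
    cases c with
    | true =>
      refine ⟨i + 1, j, by simp; omega, ?_⟩
      rw [wordProd, hw, mul_assoc, ← (h.pow_right j).eq, ← mul_assoc, pow_succ]
    | false =>
      refine ⟨i, j + 1, by simp; omega, ?_⟩
      rw [wordProd, hw, mul_assoc, pow_succ]

lemma single_pathComp {V : ℕ → Type} [∀ k, AddCommGroup (V k)] [∀ k, Module ℂ (V k)]
    [Subsingleton (V 0)] (x : ∀ k, V (k + 1) →ₗ[ℂ] V k) (y : ∀ k, V k →ₗ[ℂ] V (k + 1))
    (w : List Bool) (u : ℕ) (v : V u) :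
    Pi.single (pathEnd w u) (pathComp V x y w u v) =
      wordProd (lowerEnd x) (raiseEnd y) w (Pi.single u v) := by
  induction w generalizing u with
  | nil => rfl
  | cons c w ih =>
    cases c with
    | true =>
      cases u with
      | zero =>
        rw [Subsingleton.elim v 0, map_zero, Pi.single_zero, Pi.single_zero, map_zero]
      | succ u =>
        rw [wordProd, Module.End.mul_apply, lowerEnd_single_succ, ← ih u (x u v)]
        rfl
    | false =>
      rw [wordProd, Module.End.mul_apply, raiseEnd_single, ← ih (u + 1) (y u v)]
      rfl

/-- If a point `(x, y)` of the representation space of the double quiver of type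
`A_n` satisfies the moment map relations `x_k ∘ y_k = y_{k-1} ∘ x_{k-1}`
(for every vertex `1 ≤ k ≤ n`, with the conventions `x_0 = x_n = y_0 = y_n = 0`,
which hold automatically here since `V 0` and `V k`, `k > n`, are zero), then
`(x, y)` is nilpotent: there is `N ≥ 1` such that every composition of `N` maps
along a path in the double quiver is zero. -/
theorem momentMap_relations_implies_nilpotent
    (n : ℕ) (hn : 2 ≤ n)
    (V : ℕ → Type) [∀ k, AddCommGroup (V k)] [∀ k, Module ℂ (V k)]
    [∀ k, FiniteDimensional ℂ (V k)]
    (hV0 : Subsingleton (V 0)) (hVtop : ∀ k, n < k → Subsingleton (V k))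
    (x : ∀ k, V (k+1) →ₗ[ℂ] V k) (y : ∀ k, V k →ₗ[ℂ] V (k+1))
    (hrel : ∀ k, (x (k+1)).comp (y (k+1)) = (y k).comp (x k)) :
    ∃ N, 1 ≤ N ∧ ∀ w : List Bool, w.length = N → ∀ u, pathComp V x y w u = 0 := by
  refine ⟨2 * n + 1, by omega, fun w hw u => LinearMap.ext fun v => ?_⟩
  obtain ⟨i, j, hij, h⟩ := (commute_lowerEnd_raiseEnd hrel).exists_wordProd_eq w
  have hzero : wordProd (lowerEnd x) (raiseEnd y) w = 0 := by
    rw [h]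
    rcases (by omega : n + 1 ≤ i ∨ n + 1 ≤ j) with hi | hj
    · rw [pow_eq_zero_of_le hi (lowerEnd_pow_eq_zero hVtop x), zero_mul]
    · rw [pow_eq_zero_of_le hj (raiseEnd_pow_eq_zero hVtop y), mul_zero]
  have hs := single_pathComp x y w u v
  rw [hzero, LinearMap.zero_apply] at hs
  exact Pi.single_eq_zero_iff.mp hs

end
end

section
/- Let y = (y_k : V_k → V_{k+1}) be any tuple of linear maps such that (x, y) satisfies the moment map relations, and write y_k(v^l_k) = Σ_m c^{l,m}_k v^m_{k+1}, where the sum is over those m with i_m ≤ k+1 ≤ j_m. Then: (a) c^{l,l}_k = 0 for all l and k; and (b) if c^{l,m}_k ≠ 0 for some k, then i_l < i_m and j_l < j_m. In other words, under the moment map relations the reverse maps y kill the diagonal components of each interval summand, and can have a nonzero component from the summand [i_l, j_l] to the summand [i_m, j_m] only when i_l < i_m and j_l < j_m. -/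
noncomputable section

/-- The index set of basis vectors `v^l_k` living at vertex `k`: the summand
`l` contributes a basis vector at `k` exactly when `i_l ≤ k ≤ j_l`. -/
abbrev IntervalIdx (s : ℕ) (il jl : Fin s → ℕ) (k : ℕ) : Type :=
  {l : Fin s // il l ≤ k ∧ k ≤ jl l}

/-- The vector space at vertex `k` of the direct sum of interval representations
`V^{i_l, j_l}`, with basis `{v^l_k : i_l ≤ k ≤ j_l}`. -/
abbrev IntervalSpace (s : ℕ) (il jl : Fin s → ℕ) (k : ℕ) : Type :=
  IntervalIdx s il jl k → ℂ

/-- The structure map `x_k : V_{k+1} → V_k` of the direct sum of interval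
representations: `x_k (v^l_{k+1}) = v^l_k` if `k ≥ i_l` and `= 0` if `k+1 = i_l`. -/
def intervalX (s : ℕ) (il jl : Fin s → ℕ) (k : ℕ) :
    IntervalSpace s il jl (k+1) →ₗ[ℂ] IntervalSpace s il jl k :=
  LinearMap.pi fun l =>
    if h : il l.1 ≤ k + 1 ∧ k + 1 ≤ jl l.1 then
      LinearMap.proj (⟨l.1, h⟩ : IntervalIdx s il jl (k+1))
    else 0

theorem intervalX_apply (s : ℕ) (il jl : Fin s → ℕ) (k : ℕ) (f : IntervalSpace s il jl (k+1))
    (m : IntervalIdx s il jl k) :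
    intervalX s il jl k f m =
      if h : il m.1 ≤ k + 1 ∧ k + 1 ≤ jl m.1 then f ⟨m.1, h⟩ else 0 := by
  simp only [intervalX, LinearMap.pi_apply]
  split_ifs <;> rfl

theorem intervalX_single (s : ℕ) (il jl : Fin s → ℕ) (k : ℕ) (l : Fin s)
    (hl : il l ≤ k + 1 ∧ k + 1 ≤ jl l) :
    intervalX s il jl k (Pi.single (⟨l, hl⟩ : IntervalIdx s il jl (k+1)) 1) =
      if h : il l ≤ k ∧ k ≤ jl l then Pi.single (⟨l, h⟩ : IntervalIdx s il jl k) 1 else 0 := by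
  ext ⟨m, hm⟩
  rw [intervalX_apply]
  by_cases hml : m = l
  · subst hml
    simp [hl, hm]
  · split_ifs <;> simp [hml]

/-- The moment map relation at vertex `k + 1`, read off on the `(l, m)` coefficient. -/
theorem reverse_coeff_relation {s : ℕ} {il jl : Fin s → ℕ}
    {y : ∀ k : ℕ, IntervalSpace s il jl k →ₗ[ℂ] IntervalSpace s il jl (k+1)}
    (hrel : ∀ k, (intervalX s il jl (k+1)).comp (y (k+1)) = (y k).comp (intervalX s il jl k))
    (k : ℕ) (l m : Fin s) (hl : il l ≤ k + 1 ∧ k + 1 ≤ jl l) (hm : il m ≤ k + 1 ∧ k + 1 ≤ jl m) :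
    (if h : il m ≤ k + 1 + 1 ∧ k + 1 + 1 ≤ jl m then
        y (k+1) (Pi.single (⟨l, hl⟩ : IntervalIdx s il jl (k+1)) 1) ⟨m, h⟩ else 0) =
      if h : il l ≤ k ∧ k ≤ jl l then
        y k (Pi.single (⟨l, h⟩ : IntervalIdx s il jl k) 1) ⟨m, hm⟩ else 0 := by
  have key := congrFun (LinearMap.congr_fun (hrel k) (Pi.single ⟨l, hl⟩ 1)) ⟨m, hm⟩
  rw [LinearMap.comp_apply, LinearMap.comp_apply, intervalX_apply, intervalX_single] at key
  rw [key]
  split_ifs <;> simp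

theorem reverse_coeff_eq_zero_of_left_le {s : ℕ} {il jl : Fin s → ℕ}
    {y : ∀ k : ℕ, IntervalSpace s il jl k →ₗ[ℂ] IntervalSpace s il jl (k+1)}
    (hrel : ∀ k, (intervalX s il jl (k+1)).comp (y (k+1)) = (y k).comp (intervalX s il jl k))
    {l m : Fin s} (hpos : 1 ≤ il l) (hle : il m ≤ il l) (k : ℕ)
    (hl : il l ≤ k ∧ k ≤ jl l) (hm : il m ≤ k + 1 ∧ k + 1 ≤ jl m) :
    y k (Pi.single (⟨l, hl⟩ : IntervalIdx s il jl k) 1) ⟨m, hm⟩ = 0 := by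
  induction k with
  | zero => omega
  | succ k ih =>
    have h := reverse_coeff_relation hrel k l m hl ⟨by omega, by omega⟩
    rw [dif_pos hm] at h
    rw [h]
    split_ifs with h'
    · exact ih h' _
    · rfl

theorem reverse_coeff_eq_zero_of_right_le {s : ℕ} {il jl : Fin s → ℕ}
    {y : ∀ k : ℕ, IntervalSpace s il jl k →ₗ[ℂ] IntervalSpace s il jl (k+1)}
    (hrel : ∀ k, (intervalX s il jl (k+1)).comp (y (k+1)) = (y k).comp (intervalX s il jl k))
    {l m : Fin s} (hle : jl m ≤ jl l) (k : ℕ)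
    (hl : il l ≤ k ∧ k ≤ jl l) (hm : il m ≤ k + 1 ∧ k + 1 ≤ jl m) :
    y k (Pi.single (⟨l, hl⟩ : IntervalIdx s il jl k) 1) ⟨m, hm⟩ = 0 := by
  induction hd : jl m - k generalizing k with
  | zero => omega
  | succ d ih =>
    have h := reverse_coeff_relation hrel k l m ⟨by omega, by omega⟩ hm
    rw [dif_pos hl] at h
    rw [← h]
    split_ifs with h'
    · exact ih (k + 1) _ h' (by omega)
    · rfl

/-- Let `(V, x)` be the direct sum of interval representations `V^{i_l, j_l}`,
`1 ≤ l ≤ s`, of the `A_n` quiver, and let `y = (y_k : V_k → V_{k+1})` be reverse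
maps such that `(x, y)` satisfies the moment map relations
`x_k ∘ y_k = y_{k-1} ∘ x_{k-1}` (stated below at every vertex `k+1`; at vertex
`1` and at vertices `> n` it holds automatically since the relevant spaces
vanish).  Writing `y_k (v^l_k) = Σ_m c^{l,m}_k v^m_{k+1}`, where
`c^{l,m}_k = (y_k (v^l_k))_m`:
(a) `c^{l,l}_k = 0` for all `l, k`, and
(b) if `c^{l,m}_k ≠ 0` for some `k`, then `i_l < i_m` and `j_l < j_m`. -/
theorem reverse_maps_of_interval_sum_structure
    (n : ℕ) (hn : 2 ≤ n) (s : ℕ) (hs : 1 ≤ s)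
    (il jl : Fin s → ℕ)
    (hil : ∀ l, 1 ≤ il l) (hij : ∀ l, il l ≤ jl l) (hjn : ∀ l, jl l ≤ n)
    (y : ∀ k : ℕ, IntervalSpace s il jl k →ₗ[ℂ] IntervalSpace s il jl (k+1))
    (hrel : ∀ k, (intervalX s il jl (k+1)).comp (y (k+1)) =
      (y k).comp (intervalX s il jl k)) :
    (∀ (k : ℕ) (l : Fin s) (hl : il l ≤ k ∧ k ≤ jl l) (hl' : il l ≤ k + 1 ∧ k + 1 ≤ jl l),
        y k (Pi.single (⟨l, hl⟩ : IntervalIdx s il jl k) 1) ⟨l, hl'⟩ = 0) ∧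
    (∀ (k : ℕ) (l m : Fin s) (hl : il l ≤ k ∧ k ≤ jl l) (hm : il m ≤ k + 1 ∧ k + 1 ≤ jl m),
        y k (Pi.single (⟨l, hl⟩ : IntervalIdx s il jl k) 1) ⟨m, hm⟩ ≠ 0 →
        il l < il m ∧ jl l < jl m) := by
  have hlt : ∀ (k : ℕ) (l m : Fin s) (hl : il l ≤ k ∧ k ≤ jl l)
      (hm : il m ≤ k + 1 ∧ k + 1 ≤ jl m),
      y k (Pi.single (⟨l, hl⟩ : IntervalIdx s il jl k) 1) ⟨m, hm⟩ ≠ 0 →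
      il l < il m ∧ jl l < jl m := fun k l m hl hm hne =>
    ⟨lt_of_not_ge fun hle =>
        hne (reverse_coeff_eq_zero_of_left_le hrel (hil l) hle k hl hm),
      lt_of_not_ge fun hle =>
        hne (reverse_coeff_eq_zero_of_right_le hrel hle k hl hm)⟩
  exact ⟨fun k l hl hl' => by_contra fun hne => (hlt k l l hl hl' hne).1.false, hlt⟩

end
end

section
/- If (x, t) is stable and g = (g_i)_{i ∈ Q_0} ∈ G_V satisfies g·(x, t) = (x, t), i.e. g_{t(a)} ∘ x_a = x_a ∘ g_{s(a)} for all a ∈ Q_1 and t_i ∘ g_i = t_i for all i ∈ Q_0, then g_i = id_{V_i} for all i ∈ Q_0. In other words, the stabilizer in G_V of any stable point is trivial, so G_V acts freely on the set of stable points. -/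
/-- The stabilizer in `G_V = ∏ GL(V_i)` of a stable framed point `(x, t)` is
trivial: if `(x, t)` is stable (the only `x`-invariant tuple of subspaces
`S_i ⊆ V_i` with `t_i (S_i) = 0` for all `i` is the zero tuple) and
`g = (g_i) ∈ ∏ GL(V_i)` satisfies `g_{t(a)} ∘ x_a = x_a ∘ g_{s(a)}` for all
arrows `a` and `t_i ∘ g_i = t_i` for all vertices `i`, then `g_i = id` for all
`i`.  Hence `G_V` acts freely on the set of stable points. -/
theorem stabilizer_of_stable_point_trivial
    (Q0 Q1 : Type*) [Fintype Q0] [Fintype Q1]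
    (s t : Q1 → Q0)
    (V W : Q0 → Type*)
    [∀ i, AddCommGroup (V i)] [∀ i, Module ℂ (V i)] [∀ i, FiniteDimensional ℂ (V i)]
    [∀ i, AddCommGroup (W i)] [∀ i, Module ℂ (W i)] [∀ i, FiniteDimensional ℂ (W i)]
    (x : ∀ a, V (s a) →ₗ[ℂ] V (t a)) (tm : ∀ i, V i →ₗ[ℂ] W i)
    (hstable : ∀ S : ∀ i, Submodule ℂ (V i),
      (∀ a, Submodule.map (x a) (S (s a)) ≤ S (t a)) →
      (∀ i, S i ≤ LinearMap.ker (tm i)) →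
      ∀ i, S i = ⊥)
    (g : ∀ i, V i ≃ₗ[ℂ] V i)
    (hgx : ∀ a, (g (t a)).toLinearMap ∘ₗ x a = x a ∘ₗ (g (s a)).toLinearMap)
    (hgt : ∀ i, (tm i) ∘ₗ (g i).toLinearMap = tm i) :
    ∀ (i : Q0) (v : V i), g i v = v := by
  have hx (a : Q1) (v : V (s a)) : g (t a) (x a v) = x a (g (s a) v) :=
    LinearMap.congr_fun (hgx a) v
  have ht (i : Q0) (v : V i) : tm i (g i v) = tm i v := LinearMap.congr_fun (hgt i) v
  have hS := hstable (fun i => LinearMap.range ((g i).toLinearMap - LinearMap.id)) ?_ ?_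
  · intro i v
    have h := LinearMap.congr_fun (LinearMap.range_eq_bot.mp (hS i)) v
    simpa [sub_eq_zero] using h
  · rintro a _ ⟨_, ⟨v, rfl⟩, rfl⟩
    exact ⟨x a v, by simp [hx]⟩
  · rintro i _ ⟨v, rfl⟩
    simp [ht]
end

section
/- Suppose (x, y) satisfies the moment map relations and is nilpotent (i.e., (x, y, t) is a point of Λ(v, w)). Then (x, y, t) is stable if and only if for every 1 ≤ k ≤ n one has ker(x_{k−1} : V_k → V_{k−1}) ∩ ker(y_k : V_k → V_{k+1}) ∩ ker(t_k : V_k → W_k) = 0 (where x_0 and y_n denote the zero maps, so their kernels are all of V_k when k = 1 or k = n). -/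
noncomputable section

/-- In an invariant tuple of subspaces killed by the framing, an element annihilated by all paths
of a given length vanishes, provided the kernels of the maps out of each vertex meet trivially. -/
theorem eq_zero_of_pathComp_eq_zero
    (V W : ℕ → Type)
    [∀ k, AddCommGroup (V k)] [∀ k, Module ℂ (V k)]
    [∀ k, AddCommGroup (W k)] [∀ k, Module ℂ (W k)]
    (hV0 : Subsingleton (V 0))
    (x : ∀ k, V (k+1) →ₗ[ℂ] V k) (y : ∀ k, V k →ₗ[ℂ] V (k+1))
    (t : ∀ k, V k →ₗ[ℂ] W k)
    (hker : ∀ k,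
      LinearMap.ker (x k) ⊓ LinearMap.ker (y (k+1)) ⊓ LinearMap.ker (t (k+1)) = ⊥)
    (S : ∀ k, Submodule ℂ (V k))
    (hx : ∀ k, Submodule.map (x k) (S (k+1)) ≤ S k)
    (hy : ∀ k, Submodule.map (y k) (S k) ≤ S (k+1))
    (ht : ∀ k, S k ≤ LinearMap.ker (t k)) (m : ℕ) :
    ∀ u, ∀ s ∈ S u, (∀ w : List Bool, w.length = m → pathComp V x y w u s = 0) → s = 0 := by
  induction m with
  | zero => exact fun u s _ h => h [] rfl
  | succ m ih =>
    rintro (_ | k) s hs h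
    · exact Subsingleton.elim _ _
    · rw [← Submodule.mem_bot ℂ, ← hker k]
      refine ⟨⟨?_, ?_⟩, ht _ hs⟩
      · exact ih k _ (hx k ⟨s, hs, rfl⟩) fun w hw => h (true :: w) (congrArg (· + 1) hw)
      · exact ih (k+2) _ (hy (k+1) ⟨s, hs, rfl⟩) fun w hw =>
          h (false :: w) (congrArg (· + 1) hw)

/-- Let `(x, y)` be a point of the representation space of the double quiver of
type `A_n` satisfying the moment map relations and nilpotency (a point of
`Λ(v, w)`), together with a framing `t_k : V_k → W_k`.  Then `(x, y, t)` is
stable (the only `(x,y)`-invariant tuple of subspaces killed by all `t_k` is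
zero) if and only if for every vertex `1 ≤ k ≤ n` one has
`ker x_{k-1} ∩ ker y_k ∩ ker t_k = 0`; below the vertex is written as `k+1`
with `0 ≤ k ≤ n-1`, so the condition reads
`ker (x k) ⊓ ker (y (k+1)) ⊓ ker (t (k+1)) = ⊥` (at vertex `1` the kernel of
`x_0 : V_1 → V_0 = 0` is automatically everything, and at vertex `n` the kernel
of `y_n : V_n → V_{n+1} = 0` is automatically everything). -/
theorem stability_iff_kernel_intersections_trivial
    (n : ℕ) (hn : 2 ≤ n)
    (V W : ℕ → Type)
    [∀ k, AddCommGroup (V k)] [∀ k, Module ℂ (V k)] [∀ k, FiniteDimensional ℂ (V k)]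
    [∀ k, AddCommGroup (W k)] [∀ k, Module ℂ (W k)] [∀ k, FiniteDimensional ℂ (W k)]
    (hV0 : Subsingleton (V 0)) (hVtop : ∀ k, n < k → Subsingleton (V k))
    (x : ∀ k, V (k+1) →ₗ[ℂ] V k) (y : ∀ k, V k →ₗ[ℂ] V (k+1))
    (t : ∀ k, V k →ₗ[ℂ] W k)
    (hrel : ∀ k, (x (k+1)).comp (y (k+1)) = (y k).comp (x k))
    (hnilp : ∃ N, 1 ≤ N ∧ ∀ w : List Bool, w.length = N → ∀ u, pathComp V x y w u = 0) :
    (∀ S : ∀ k, Submodule ℂ (V k),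
        (∀ k, Submodule.map (x k) (S (k+1)) ≤ S k) →
        (∀ k, Submodule.map (y k) (S k) ≤ S (k+1)) →
        (∀ k, S k ≤ LinearMap.ker (t k)) →
        ∀ k, S k = ⊥) ↔
      (∀ k, k + 1 ≤ n →
        LinearMap.ker (x k) ⊓ LinearMap.ker (y (k+1)) ⊓ LinearMap.ker (t (k+1)) = ⊥) := by
  constructor
  · intro h k _
    set K := LinearMap.ker (x k) ⊓ LinearMap.ker (y (k+1)) ⊓ LinearMap.ker (t (k+1))
    have hS := h (Function.update (fun _ => ⊥) (k+1) K) ?_ ?_ ?_ (k+1)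
    · simpa using hS
    · intro j
      rcases eq_or_ne j k with rfl | hj
      · rw [Function.update_self, Submodule.map_le_iff_le_comap]
        intro v hv
        rw [Submodule.mem_comap, show x j v = 0 from hv.1.1]
        exact zero_mem _
      · rw [Function.update_of_ne (by omega), Submodule.map_bot]
        exact bot_le
    · intro j
      rcases eq_or_ne j (k+1) with rfl | hj
      · rw [Function.update_self, Submodule.map_le_iff_le_comap]
        intro v hv
        rw [Submodule.mem_comap, show y (k+1) v = 0 from hv.1.2]
        exact zero_mem _
      · rw [Function.update_of_ne hj, Submodule.map_bot]
        exact bot_le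
    · intro j
      rcases eq_or_ne j (k+1) with rfl | hj
      · rw [Function.update_self]
        exact inf_le_right
      · rw [Function.update_of_ne hj]
        exact bot_le
  · intro h S hx hy ht k
    obtain ⟨N, -, hN⟩ := hnilp
    have hker (j : ℕ) :
        LinearMap.ker (x j) ⊓ LinearMap.ker (y (j+1)) ⊓ LinearMap.ker (t (j+1)) = ⊥ := by
      by_cases hj : j + 1 ≤ n
      · exact h j hj
      · have := hVtop (j+1) (by omega)
        exact Subsingleton.elim _ _
    refine (Submodule.eq_bot_iff _).2 fun s hs => ?_
    refine eq_zero_of_pathComp_eq_zero V W hV0 x y t hker S hx hy ht N k s hs fun w hw => ?_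
    rw [hN w hw k, LinearMap.zero_apply]

end
end

section
/- Suppose the intervals are ordered so that i_1 ≥ i_2 ≥ ⋯ ≥ i_s, and suppose y = (y_k : V_k → V_{k+1}) and t_r : V_r → ℂ are such that (x, y) satisfies the moment map relations and (x, y, t) is stable. Then i_1 = r, i_{l+1} = i_l − 1 for 1 ≤ l ≤ s−1 (so i_l = r − l + 1 for all l), and j_1 > j_2 > ⋯ > j_s. -/
noncomputable section

/-- The basis vector `v^l_k`, read as `0` when the summand `l` does not reach the vertex `k`. -/
def intervalVec (s : ℕ) (il jl : Fin s → ℕ) (l : Fin s) (k : ℕ) : IntervalSpace s il jl k :=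
  fun i => if i.1 = l then 1 else 0

section

variable {s : ℕ} {il jl : Fin s → ℕ}

theorem intervalX_apply_of_le {k : ℕ} (v : IntervalSpace s il jl (k + 1))
    (i : IntervalIdx s il jl k) (h : il i.1 ≤ k + 1 ∧ k + 1 ≤ jl i.1) :
    intervalX s il jl k v i = v ⟨i.1, h⟩ := by
  rw [intervalX, LinearMap.pi_apply, dif_pos h]
  rfl

theorem intervalX_apply_of_lt {k : ℕ} (v : IntervalSpace s il jl (k + 1))
    (i : IntervalIdx s il jl k) (h : jl i.1 < k + 1) :
    intervalX s il jl k v i = 0 := by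
  have h' : ¬ (il i.1 ≤ k + 1 ∧ k + 1 ≤ jl i.1) := by omega
  rw [intervalX, LinearMap.pi_apply, dif_neg h']
  rfl

theorem intervalX_intervalVec {l : Fin s} {k : ℕ} (h : k + 1 ≤ jl l) :
    intervalX s il jl k (intervalVec s il jl l (k + 1)) = intervalVec s il jl l k := by
  funext i
  by_cases hi : k + 1 ≤ jl i.1
  · rw [intervalX_apply_of_le _ _ ⟨by have := i.2.1; omega, hi⟩]
    rfl
  · rw [intervalX_apply_of_lt _ _ (by omega)]
    have : i.1 ≠ l := by rintro rfl; exact hi h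
    simp [intervalVec, this]

theorem intervalX_intervalVec_of_lt {l : Fin s} {k : ℕ} (h : k < il l) :
    intervalX s il jl k (intervalVec s il jl l (k + 1)) = 0 := by
  funext i
  have hne : i.1 ≠ l := by
    rintro rfl
    have := i.2.1
    omega
  by_cases hi : k + 1 ≤ jl i.1
  · rw [intervalX_apply_of_le _ _ ⟨by have := i.2.1; omega, hi⟩]
    simp [intervalVec, hne]
  · rw [intervalX_apply_of_lt _ _ (by omega)]
    rfl

theorem eq_succ_of_intervalX_eq_zero {k : ℕ} {v : IntervalSpace s il jl (k + 1)}
    (hv : intervalX s il jl k v = 0) {i : IntervalIdx s il jl (k + 1)} (hi : v i ≠ 0) :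
    il i.1 = k + 1 := by
  by_contra h
  have h1 := i.2
  have := intervalX_apply_of_le v ⟨i.1, by omega, by omega⟩ h1
  rw [hv] at this
  exact hi this.symm

/-- If `y` sends the socle vector of the summand `l` to a vector with nonzero component along the
summand `m`, then `m` reaches strictly further to the right than `l`. -/
theorem lt_of_apply_intervalVec_ne_zero
    (y : ∀ k : ℕ, IntervalSpace s il jl k →ₗ[ℂ] IntervalSpace s il jl (k + 1))
    (hrel : ∀ k, (intervalX s il jl (k + 1)).comp (y (k + 1)) =
      (y k).comp (intervalX s il jl k))
    {l m : Fin s} (hl : il l ≤ jl l) (hm : il m ≤ il l + 1 ∧ il l + 1 ≤ jl m)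
    (hne : y (il l) (intervalVec s il jl l (il l)) ⟨m, hm⟩ ≠ 0) : jl l < jl m := by
  have key : ∀ k, il l ≤ k → k ≤ jl l →
      ∃ h : il m ≤ k + 1 ∧ k + 1 ≤ jl m, y k (intervalVec s il jl l k) ⟨m, h⟩ ≠ 0 := by
    intro k hk
    induction k, hk using Nat.le_induction with
    | base => exact fun _ => ⟨hm, hne⟩
    | succ k hk ih =>
      intro hkj
      obtain ⟨h, hy⟩ := ih (by omega)
      have hxy := LinearMap.congr_fun (hrel k) (intervalVec s il jl l (k + 1))
      simp only [LinearMap.comp_apply] at hxy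
      rw [intervalX_intervalVec hkj] at hxy
      rw [← hxy] at hy
      by_cases hj : k + 1 + 1 ≤ jl m
      · have h' : il m ≤ k + 1 + 1 ∧ k + 1 + 1 ≤ jl m := ⟨by omega, hj⟩
        rw [intervalX_apply_of_le _ _ h'] at hy
        exact ⟨h', hy⟩
      · exact absurd (intervalX_apply_of_lt _ _ (by simpa using hj)) hy
  obtain ⟨h, -⟩ := key _ hl le_rfl
  omega

end

/-- A functional at one vertex pulls back along the maps `y` to all earlier vertices. -/
theorem exists_pullback_family {V : ℕ → Type*} [∀ k, AddCommGroup (V k)] [∀ k, Module ℂ (V k)]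
    (y : ∀ k, V k →ₗ[ℂ] V (k + 1)) (r : ℕ) (t : V r →ₗ[ℂ] ℂ) :
    ∃ f : ∀ k, V k →ₗ[ℂ] ℂ, f r = t ∧ (∀ k < r, f k = (f (k + 1)).comp (y k)) ∧
      ∀ k, r < k → f k = 0 := by
  refine ⟨fun k => if h : k ≤ r then
    Nat.decreasingInduction (motive := fun k _ => V k →ₗ[ℂ] ℂ) (fun k _ g => g.comp (y k)) t h
    else 0, ?_, ?_, ?_⟩
  · simp
  · intro k hk
    have h' : k + 1 ≤ r := hk
    simp only [hk.le, h', dite_true]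
    rw [Nat.decreasingInduction_succ_left]
  · intro k hk
    simp [Nat.not_le.2 hk]

/-- Stability makes some family of functionals, compatible with `y`, injective on `ker x`. -/
theorem exists_family_injective_on_ker {s : ℕ} {il jl : Fin s → ℕ} {r : ℕ} (h1r : 1 ≤ r)
    (y : ∀ k : ℕ, IntervalSpace s il jl k →ₗ[ℂ] IntervalSpace s il jl (k + 1))
    (t : IntervalSpace s il jl r →ₗ[ℂ] ℂ)
    (hrel : ∀ k, (intervalX s il jl (k + 1)).comp (y (k + 1)) =
      (y k).comp (intervalX s il jl k))
    (hstable : ∀ S : ∀ k, Submodule ℂ (IntervalSpace s il jl k),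
      (∀ k, Submodule.map (intervalX s il jl k) (S (k + 1)) ≤ S k) →
      (∀ k, Submodule.map (y k) (S k) ≤ S (k + 1)) →
      S r ≤ LinearMap.ker t →
      ∀ k, S k = ⊥) :
    ∃ f : ∀ k, IntervalSpace s il jl k →ₗ[ℂ] ℂ,
      (∀ k < r, f k = (f (k + 1)).comp (y k)) ∧ (∀ k, r < k → f k = 0) ∧
      ∀ k v, intervalX s il jl k v = 0 → f (k + 1) v = 0 → v = 0 := by
  obtain ⟨f, hfr, hfy, hf0⟩ := exists_pullback_family y r t
  refine ⟨f, hfy, hf0, fun k v hx hf => ?_⟩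
  let S : ∀ k, Submodule ℂ (IntervalSpace s il jl k)
    | 0 => ⊥
    | k + 1 => LinearMap.ker (intervalX s il jl k) ⊓ LinearMap.ker (f (k + 1))
  have hS : S (k + 1) = ⊥ := by
    refine hstable S ?_ ?_ ?_ (k + 1)
    · rintro k _ ⟨w, hw, rfl⟩
      have : intervalX s il jl k w = 0 := hw.1
      rw [this]
      exact zero_mem _
    · rintro (_ | k) _ ⟨w, hw, rfl⟩
      · have : w = 0 := hw
        rw [this, map_zero]
        exact zero_mem _
      · have hw1 : intervalX s il jl k w = 0 := hw.1
        have hw2 : f (k + 1) w = 0 := hw.2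
        refine ⟨?_, ?_⟩
        · have := LinearMap.congr_fun (hrel k) w
          simpa [hw1] using this
        · by_cases hk : k + 1 < r
          · rw [hfy _ hk] at hw2
            exact hw2
          · simp [hf0 (k + 1 + 1) (by omega)]
    · obtain ⟨r, rfl⟩ := Nat.exists_eq_add_of_le' h1r
      rw [← hfr]
      exact inf_le_right
  have hv : v ∈ S (k + 1) := ⟨hx, hf⟩
  rw [hS] at hv
  exact hv

/-- Let `(V, x)` be the direct sum of interval representations `V^{i_l, j_l}`,
`1 ≤ l ≤ s`, ordered so that `i_1 ≥ i_2 ≥ ⋯ ≥ i_s`, with framing `W_r = ℂ`,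
`W_k = 0` for `k ≠ r`.  Suppose `y` is such that `(x, y)` satisfies the moment
map relations (recorded below at every vertex `k+1`) and `(x, y, t)` is stable.
Then `i_1 = r`, `i_{l+1} = i_l − 1` for `1 ≤ l ≤ s−1` (so `i_l = r − l + 1`,
i.e. `i_l = r − (l−1)` for all `l`), and `j_1 > j_2 > ⋯ > j_s`.  (Summands are
indexed by `Fin s`, so the summand `l` of the paper is `⟨l-1, _⟩` here.) -/
theorem stable_point_forces_interval_pattern
    (n : ℕ) (hn : 2 ≤ n) (s : ℕ) (hs : 0 < s) (r : ℕ) (h1r : 1 ≤ r) (hrn : r ≤ n)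
    (il jl : Fin s → ℕ)
    (hil : ∀ l, 1 ≤ il l) (hij : ∀ l, il l ≤ jl l) (hjn : ∀ l, jl l ≤ n)
    (horder : ∀ l m : Fin s, l ≤ m → il m ≤ il l)
    (y : ∀ k : ℕ, IntervalSpace s il jl k →ₗ[ℂ] IntervalSpace s il jl (k+1))
    (t : IntervalSpace s il jl r →ₗ[ℂ] ℂ)
    (hrel : ∀ k, (intervalX s il jl (k+1)).comp (y (k+1)) =
      (y k).comp (intervalX s il jl k))
    (hstable : ∀ S : ∀ k, Submodule ℂ (IntervalSpace s il jl k),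
      (∀ k, Submodule.map (intervalX s il jl k) (S (k+1)) ≤ S k) →
      (∀ k, Submodule.map (y k) (S k) ≤ S (k+1)) →
      S r ≤ LinearMap.ker t →
      ∀ k, S k = ⊥) :
    il ⟨0, hs⟩ = r ∧
    (∀ (l : ℕ) (h : l + 1 < s),
      il ⟨l + 1, h⟩ = il ⟨l, Nat.lt_of_succ_lt h⟩ - 1) ∧
    (∀ l : Fin s, il l = r - l.1) ∧
    (∀ l m : Fin s, l < m → jl m < jl l) := by
  obtain ⟨f, hfy, hf0, hinj⟩ := exists_family_injective_on_ker h1r y t hrel hstable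
  have hx : ∀ l k, il l = k + 1 → intervalX s il jl k (intervalVec s il jl l (k + 1)) = 0 :=
    fun l k h => intervalX_intervalVec_of_lt (by omega)
  have hone : ∀ l k, ∀ h : il l ≤ k ∧ k ≤ jl l, intervalVec s il jl l k ⟨l, h⟩ = 1 :=
    fun l k h => by simp [intervalVec]
  have hf : ∀ l k, il l = k + 1 → f (k + 1) (intervalVec s il jl l (k + 1)) ≠ 0 := by
    intro l k h hz
    have h0 := hinj k _ (hx l k h) hz
    have h1 := hone l (k + 1) ⟨h.le, by have := hij l; omega⟩
    rw [h0] at h1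
    exact zero_ne_one h1
  have hle : ∀ l, il l ≤ r := by
    intro l
    obtain ⟨k, hk⟩ := Nat.exists_eq_add_of_le' (hil l)
    by_contra h
    exact hf l k hk (by rw [hf0 _ (by omega)]; rfl)
  have hinjil : Function.Injective il := by
    intro l m hlm
    obtain ⟨k, hk⟩ := Nat.exists_eq_add_of_le' (hil l)
    by_contra hne
    set a := f (k + 1) (intervalVec s il jl l (k + 1))
    set b := f (k + 1) (intervalVec s il jl m (k + 1))
    have hz : b • intervalVec s il jl l (k + 1) - a • intervalVec s il jl m (k + 1) = 0 := by
      refine hinj k _ ?_ ?_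
      · simp [hx l k hk, hx m k (hlm ▸ hk)]
      · simp [a, b, mul_comm]
    have h1 := congrFun hz ⟨l, hk.le, by have := hij l; omega⟩
    simp [intervalVec, hne] at h1
    exact hf m k (hlm ▸ hk) h1
  have hnext : ∀ l, il l < r → ∃ m, il m = il l + 1 ∧ jl l < jl m := by
    intro l hl
    obtain ⟨k, hk⟩ := Nat.exists_eq_add_of_le' (hil l)
    have hfv : f (il l) (intervalVec s il jl l (il l)) ≠ 0 := by
      have := hf l k hk
      rwa [← hk] at this
    have hker : intervalX s il jl (il l) (y (il l) (intervalVec s il jl l (il l))) = 0 := by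
      have := LinearMap.congr_fun (hrel k) (intervalVec s il jl l (k + 1))
      simp only [LinearMap.comp_apply, hx l k hk, map_zero] at this
      rwa [← hk] at this
    have hy : y (il l) (intervalVec s il jl l (il l)) ≠ 0 := by
      intro h
      rw [hfy _ hl, LinearMap.comp_apply, h, map_zero] at hfv
      exact hfv rfl
    obtain ⟨i, hi⟩ := Function.ne_iff.1 hy
    exact ⟨i.1, eq_succ_of_intervalX_eq_zero hker hi,
      lt_of_apply_intervalVec_ne_zero y hrel (hij l) i.2 hi⟩
  have hfirst : il ⟨0, hs⟩ = r := by
    by_contra h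
    obtain ⟨m, hm, -⟩ := hnext ⟨0, hs⟩ (lt_of_le_of_ne (hle _) h)
    have := horder ⟨0, hs⟩ m (Nat.zero_le _)
    omega
  have hstep : ∀ (l : ℕ) (h : l + 1 < s),
      il ⟨l + 1, h⟩ + 1 = il ⟨l, Nat.lt_of_succ_lt h⟩ ∧
        jl ⟨l + 1, h⟩ < jl ⟨l, Nat.lt_of_succ_lt h⟩ := by
    intro l h
    have hlt : il ⟨l + 1, h⟩ < il ⟨l, Nat.lt_of_succ_lt h⟩ := by
      refine lt_of_le_of_ne (horder _ _ (Nat.le_succ l)) fun he => ?_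
      have := congrArg Fin.val (hinjil he)
      simp at this
    obtain ⟨m, hm, hj⟩ := hnext _ (hlt.trans_le (hle _))
    have heq : il m = il ⟨l, Nat.lt_of_succ_lt h⟩ := by
      have hml : m.1 ≤ l := by
        by_contra hml
        have := horder ⟨l + 1, h⟩ m (by rw [Fin.le_def]; simp; omega)
        omega
      have := horder m ⟨l, Nat.lt_of_succ_lt h⟩ hml
      omega
    have := hinjil heq
    subst this
    exact ⟨hm.symm, hj⟩
  refine ⟨hfirst, fun l h => by have := (hstep l h).1; omega, ?_, ?_⟩
  · rintro ⟨l, h⟩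
    induction l with
    | zero => exact hfirst
    | succ l ih =>
      have h1 := (hstep l h).1
      have h2 := ih (by omega)
      simp only at h2 ⊢
      omega
  · rintro ⟨l, hl⟩ ⟨m, hm⟩ hlm
    have hlm' : l + 1 ≤ m := hlm
    clear hlm
    induction m, hlm' using Nat.le_induction with
    | base => exact (hstep l hm).2
    | succ m _ ih => exact (hstep m hm).2.trans (ih (by omega))

end
end
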